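/- Let q = p^e be a prime power and let k, n be positive integers with k > 2n, (q − 1) ∣ (k − 2n), and n ≤ p^{v_p(k−n)}. Let d ≥ 1 be an integer such that ∑_{a ∈ A_{<d}} a^j = 0 for every integer j with 1 ≤ j ≤ k − 2n. Let L be a field extension of the rational function field 𝔽_q(T) and let z ∈ L be transcendental over 𝔽_q(T). Let a, b ∈ A = 𝔽_q[T] with T^d ∣ a, T^d ∣ b, and (a, b) ≠ (0, 0). Then, regarding elements of A as elements of L, one has the identity of finite sums ∑_{(u,v) ∈ A_{<d}²} (a + u)^{k−n} / ((a + u) z + b + v)^n = ∑_{(u,v) ∈ A_{<d}² \ {(0,0)}} (b u − a v)^{k−n} / ( (a z + b)^{k−n} · ((a + u) z + b + v)^n ), where on the left-hand side any term with a + u = 0 (which forces a = u = 0) is interpreted as 0 since its numerator vanishes, and all occurring denominators are nonzero in L. -/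

import Mathlib

open Polynomial

/-- If the power sums of `f` over `s` of exponents `0, …, N` vanish, so do those of every
translate of `f`. -/
theorem sum_add_pow_eq_zero {ι R : Type*} [CommRing R] (s : Finset ι) (f : ι → R) (N : ℕ)
    (h : ∀ j ≤ N, ∑ i ∈ s, f i ^ j = 0) (c : R) {m : ℕ} (hm : m ≤ N) :
    ∑ i ∈ s, (f i + c) ^ m = 0 := by
  simp_rw [add_pow]
  rw [Finset.sum_comm]
  refine Finset.sum_eq_zero fun j hj => ?_
  rw [Finset.mem_range] at hj
  rw [← Finset.sum_mul, ← Finset.sum_mul, h j (by omega), zero_mul, zero_mul]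

/-- Binomial expansion of `(x - t * y) ^ (p ^ r * m) / y ^ n` in characteristic `p`: when
`n ≤ p ^ r`, only the leading term has a pole at `y = 0`. -/
theorem sub_mul_pow_div_pow {K : Type*} [Field K] (p : ℕ) [Fact p.Prime] [CharP K p]
    (r m n : ℕ) (hn : n ≤ p ^ r) (x t y : K) (hy : y ≠ 0) :
    (x - t * y) ^ (p ^ r * m) / y ^ n = x ^ (p ^ r * m) / y ^ n +
      ∑ i ∈ Finset.range m, (-t ^ p ^ r) ^ (i + 1) * (x ^ p ^ r) ^ (m - (i + 1)) *
        (m.choose (i + 1) : K) * y ^ (p ^ r * (i + 1) - n) := by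
  have hexp : (x - t * y) ^ (p ^ r * m) = (-t ^ p ^ r * y ^ p ^ r + x ^ p ^ r) ^ m := by
    rw [pow_mul, sub_pow_char_pow, mul_pow]
    congr 1
    ring
  rw [hexp, add_pow, Finset.sum_range_succ', add_comm, add_div, Finset.sum_div]
  congr 1
  · simp [pow_mul]
  · refine Finset.sum_congr rfl fun i _ => ?_
    have hle : n ≤ p ^ r * (i + 1) := hn.trans (Nat.le_mul_of_pos_right _ i.succ_pos)
    rw [div_eq_iff (pow_ne_zero _ hy), mul_assoc _ (y ^ _) (y ^ n), ← pow_add,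
      Nat.sub_add_cancel hle, mul_pow, ← pow_mul y]
    ring

theorem finite_setOf_degree_lt (F : Type*) [Field F] [Finite F] (d : ℕ) :
    {a : F[X] | a.degree < (d : WithBot ℕ)}.Finite := by
  have : Finite (degreeLT F d) := Finite.of_equiv _ (degreeLTEquiv F d).toEquiv.symm
  convert Set.toFinite (degreeLT F d : Set F[X]) using 1
  ext a
  simp [mem_degreeLT]

theorem ncard_setOf_degree_lt (F : Type*) [Field F] [Fintype F] (d : ℕ) :
    {a : F[X] | a.degree < (d : WithBot ℕ)}.ncard = Fintype.card F ^ d := by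
  have h : {a : F[X] | a.degree < (d : WithBot ℕ)} = (degreeLT F d : Set F[X]) := by
    ext a
    simp [mem_degreeLT]
  rw [h, ← Nat.card_coe_set_eq]
  refine (Nat.card_congr (degreeLTEquiv F d).toEquiv).trans ?_
  simp

theorem eq_zero_of_X_pow_dvd_of_add_eq_zero {F : Type*} [Field F] {d : ℕ} {a u : F[X]}
    (ha : X ^ d ∣ a) (hu : u.degree < (d : WithBot ℕ)) (h : a + u = 0) : a = 0 := by
  have hdvd : X ^ d ∣ u := (dvd_add_right ha).1 (h ▸ dvd_zero _)
  have hu0 : u = 0 := eq_zero_of_dvd_of_degree_lt hdvd (by rwa [degree_X_pow])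
  simpa [hu0] using h

theorem Transcendental.mul_add_ne_zero {K L : Type*} [Field K] [Field L] [Algebra K L] {z : L}
    (hz : Transcendental K z) {x y : K} (h : ¬(x = 0 ∧ y = 0)) :
    algebraMap K L x * z + algebraMap K L y ≠ 0 := by
  intro h0
  have hp := (transcendental_iff.1 hz) (C x * X + C y) (by simpa using h0)
  refine h ⟨?_, ?_⟩
  · simpa using congrArg (coeff · 1) hp
  · simpa using congrArg (coeff · 0) hp

/-- Lemma 3 of the paper. Let `q = p^e` be a prime power and `k, n`
positive integers with `k > 2n`, `(q-1) ∣ (k-2n)` and `n ≤ p^{v_p(k-n)}`. Let `d ≥ 1` be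
such that `∑_{a ∈ A_{<d}} a^j = 0` for `1 ≤ j ≤ k - 2n`. Let `L` be a field extension of
`𝔽_q(T)`, `z ∈ L` transcendental over `𝔽_q(T)`, and `a, b ∈ T^d·A` not both zero. Then
`∑_{(u,v) ∈ A_{<d}²} (a+u)^{k-n}/((a+u)z + b + v)^n
  = ∑'_{(u,v) ∈ A_{<d}²} (bu - av)^{k-n}/((az+b)^{k-n}((a+u)z + b + v)^n)`,
the prime meaning `(u,v) ≠ (0,0)`. -/
theorem lemma_three (p e : ℕ) (hp : p.Prime) (he : 0 < e)
    (F : Type*) [Field F] [Fintype F] (hcard : Fintype.card F = p ^ e)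
    (k n : ℕ) (hn : 0 < n) (hk : 2 * n < k)
    (hmod : (p ^ e - 1) ∣ (k - 2 * n))
    (hval : n ≤ p ^ padicValNat p (k - n))
    (d : ℕ) (hd : 1 ≤ d)
    (hsum : ∀ j : ℕ, 1 ≤ j → j ≤ k - 2 * n →
      (∑ᶠ a ∈ {a : Polynomial F | a.degree < (d : WithBot ℕ)}, a ^ j) = 0)
    (L : Type*) [Field L] [Algebra (RatFunc F) L]
    (z : L) (hz : Transcendental (RatFunc F) z)
    (a b : Polynomial F) (ha : X ^ d ∣ a) (hb : X ^ d ∣ b) (hab : ¬(a = 0 ∧ b = 0)) :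
    (∑ᶠ uv ∈ {uv : Polynomial F × Polynomial F |
        uv.1.degree < (d : WithBot ℕ) ∧ uv.2.degree < (d : WithBot ℕ)},
      algebraMap (RatFunc F) L (algebraMap (Polynomial F) (RatFunc F) (a + uv.1)) ^ (k - n) /
        (algebraMap (RatFunc F) L (algebraMap (Polynomial F) (RatFunc F) (a + uv.1)) * z +
          algebraMap (RatFunc F) L (algebraMap (Polynomial F) (RatFunc F) (b + uv.2))) ^ n) =
    (∑ᶠ uv ∈ {uv : Polynomial F × Polynomial F |
        uv.1.degree < (d : WithBot ℕ) ∧ uv.2.degree < (d : WithBot ℕ) ∧ uv ≠ 0},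
      algebraMap (RatFunc F) L
          (algebraMap (Polynomial F) (RatFunc F) (b * uv.1 - a * uv.2)) ^ (k - n) /
        ((algebraMap (RatFunc F) L (algebraMap (Polynomial F) (RatFunc F) a) * z +
            algebraMap (RatFunc F) L (algebraMap (Polynomial F) (RatFunc F) b)) ^ (k - n) *
          (algebraMap (RatFunc F) L (algebraMap (Polynomial F) (RatFunc F) (a + uv.1)) * z +
            algebraMap (RatFunc F) L
              (algebraMap (Polynomial F) (RatFunc F) (b + uv.2))) ^ n)) := by
  have : Fact p.Prime := ⟨hp⟩
  set φ : F[X] →+* L := (algebraMap (RatFunc F) L).comp (algebraMap F[X] (RatFunc F)) with hφ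
  have hφ' : ∀ x : F[X], algebraMap (RatFunc F) L (algebraMap F[X] (RatFunc F) x) = φ x :=
    fun _ => rfl
  have hne : ∀ x y : F[X], ¬(x = 0 ∧ y = 0) → φ x * z + φ y ≠ 0 := fun x y h =>
    hz.mul_add_ne_zero (by simpa using h)
  have : CharP F p := by
    obtain ⟨c, hc⟩ := CharP.exists F
    obtain ⟨m, hc', hm⟩ := FiniteField.card F c
    have hdvd : c ∣ p ^ e := by
      rw [← hcard, hm]
      exact dvd_pow_self c m.ne_zero
    rwa [← (Nat.prime_dvd_prime_iff_eq hc' hp).1 (hc'.dvd_of_dvd_pow hdvd)]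
  have : CharP L p := charP_of_injective_ringHom (φ.comp C).injective p
  have hfin := finite_setOf_degree_lt F d
  set s : Finset F[X] := hfin.toFinset with hs
  have hmem : ∀ x, x ∈ s ↔ x.degree < (d : WithBot ℕ) := fun x => by simp [hs]
  have hpow : ∀ j ≤ k - 2 * n, ∑ x ∈ s, φ x ^ j = 0 := by
    intro j hj
    rcases Nat.eq_zero_or_pos j with rfl | hj0
    · have hc : s.card = p ^ (e * d) := by
        rw [hs, ← Set.ncard_eq_toFinset_card _ hfin, ncard_setOf_degree_lt, hcard, pow_mul]
      have : e * d ≠ 0 := by positivity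
      simp [hc, this]
    · have h := hsum j hj0 hj
      rw [finsum_mem_eq_finite_toFinset_sum _ hfin] at h
      simpa using congrArg φ h
  obtain ⟨m, hm⟩ : p ^ padicValNat p (k - n) ∣ k - n := pow_padicValNat_dvd
  simp only [hφ']
  have hw : φ a * z + φ b ≠ 0 := hne a b hab
  set w := φ a * z + φ b with hw_def
  have hden : ∀ u ∈ s, ∀ v ∈ s, φ (a + u) * z + φ (b + v) ≠ 0 := fun u hu v hv =>
    hne _ _ fun h => hab
      ⟨eq_zero_of_X_pow_dvd_of_add_eq_zero ha ((hmem u).1 hu) h.1,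
        eq_zero_of_X_pow_dvd_of_add_eq_zero hb ((hmem v).1 hv) h.2⟩
  have hkn : k - n ≠ 0 := by omega
  rw [finsum_mem_eq_sum_of_inter_support_eq (t := s ×ˢ s) _ (by
      congr 1
      ext ⟨u, v⟩
      simp [hmem]),
    finsum_mem_eq_sum_of_inter_support_eq (t := s ×ˢ s) _ (by
      ext ⟨u, v⟩
      simp only [Set.mem_inter_iff, Set.mem_ofPred_eq, Function.mem_support, Finset.mem_coe,
        Finset.mem_product, hmem, and_assoc, and_congr_right_iff]
      refine fun _ _ => and_iff_right_of_imp fun h h0 => h ?_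
      obtain ⟨rfl, rfl⟩ := Prod.mk_eq_zero.1 h0
      simp [hkn]),
    Finset.sum_product, Finset.sum_product]
  refine Finset.sum_congr rfl fun u hu => ?_
  have hterm : ∀ v ∈ s, φ (b * u - a * v) ^ (k - n) /
      (w ^ (k - n) * (φ (a + u) * z + φ (b + v)) ^ n) =
      (φ (a + u) - φ a / w * (φ (a + u) * z + φ (b + v))) ^ (k - n) /
        (φ (a + u) * z + φ (b + v)) ^ n := by
    intro v _
    rw [← div_div, ← div_pow]
    congr 2
    field_simp
    simp only [hw_def, map_sub, map_mul, map_add]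
    ring
  rw [Finset.sum_congr rfl hterm, hm]
  rw [Finset.sum_congr rfl fun v hv => sub_mul_pow_div_pow p (padicValNat p (k - n)) m n hval
    (φ (a + u)) (φ a / w) _ (hden u hu v hv), Finset.sum_add_distrib, left_eq_add,
    Finset.sum_comm]
  refine Finset.sum_eq_zero fun i hi => ?_
  rw [← Finset.mul_sum]
  have hle : p ^ padicValNat p (k - n) * (i + 1) - n ≤ k - 2 * n := by
    have := Nat.mul_le_mul_left (p ^ padicValNat p (k - n)) (Finset.mem_range.1 hi)
    rw [← hm] at this
    simp only [Nat.succ_eq_add_one] at this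
    omega
  have h0 := sum_add_pow_eq_zero s φ _ hpow (φ (a + u) * z + φ b) hle
  rw [Finset.sum_congr rfl fun v _ => ?_, h0, mul_zero]
  rw [map_add φ b v]
  ring
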